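/- arXiv:0706.3478 — 2 statements merged into one kernel-verified Lean document; each statement's English description precedes it below -/
import Mathlib

section
/- Let g ≥ 3 be an integer and let α ∈ R^i_{(j)}. Then for all integers n ≥ 0 and a ≥ 0 one has 𝒟ⁿ(x₁^a·α) = Σ_{s=0}^{min(n,a)} (n!/(n−s)!)·(a!/(a−s)!)·binom(2i−j−g+a−n+s−1, s)·x₁^{a−s}·𝒟^{n−s}(α), where binom(z, s) = z(z−1)⋯(z−s+1)/s! is the generalized binomial coefficient (the upper entry may be negative). -/
/- We model the polynomial ring `R = ℚ[x₁, x₂, …]` as `MvPolynomial ℕ ℚ`, where the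
variable of index `v : ℕ` represents `x_{v+1}`.  Thus `x_k = X (k-1)` for `k ≥ 1`. -/

open MvPolynomial

noncomputable section

/-- The codimension of a monomial exponent vector: `codim x_{v+1} = v + 1`. -/
def codimW (d : ℕ →₀ ℕ) : ℕ := d.sum fun v e => (v + 1) * e

/-- The level of a monomial exponent vector: `ℓ(x_{v+1}) = v`. -/
def levelW (d : ℕ →₀ ℕ) : ℕ := d.sum fun v e => v * e

/-- `R^i_{(j)}`: the ℚ-span of the monomials of codimension `i` and level `j`. -/
def Rij (i j : ℕ) : Submodule ℚ (MvPolynomial ℕ ℚ) :=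
  Submodule.span ℚ
    { p | ∃ d : ℕ →₀ ℕ, codimW d = i ∧ levelW d = j ∧ p = monomial d (1 : ℚ) }

/-- Polishchuk's operator
`𝒟 = -g ∂₁ + (1/2) ∑_{m,n ≥ 1} binom(m+n, n) x_{m+n-1} ∂_m ∂_n`.
In our indexing (`x_k = X (k-1)`), with `a = m - 1`, `b = n - 1`, the second term is
`(1/2) ∑_{a,b ≥ 0} binom(a+b+2, b+1) X(a+b) ∂_{X a} ∂_{X b}`.  On any given polynomial
only finitely many terms are nonzero (`∂_b p = 0` unless the variable `b` occurs in `p`),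
so we may cut off the sum at any bound exceeding all variable indices occurring in `p`. -/
def Dop (g : ℕ) (p : MvPolynomial ℕ ℚ) : MvPolynomial ℕ ℚ :=
  -(g : ℚ) • pderiv 0 p +
    (1/2 : ℚ) •
      ∑ a ∈ Finset.range (p.vars.sup id + 1), ∑ b ∈ Finset.range (p.vars.sup id + 1),
        (((a + b + 2).choose (b + 1) : ℚ)) • (X (a + b) * pderiv a (pderiv b p))

/-- Generalized binomial coefficient `binom(z, s) = z(z-1)⋯(z-s+1)/s!` for `z : ℤ`. -/
def gbinom (z : ℤ) (s : ℕ) : ℚ :=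
  (∏ t ∈ Finset.range s, ((z : ℚ) - t)) / (Nat.factorial s)

lemma gbinom_zero (z : ℤ) : gbinom z 0 = 1 := by simp [gbinom]

lemma succ_mul_gbinom_succ (z : ℤ) (s : ℕ) :
    ((s : ℚ) + 1) * gbinom z (s + 1) = ((z : ℚ) - s) * gbinom z s := by
  have hs : (s.factorial : ℚ) ≠ 0 := Nat.cast_ne_zero.2 s.factorial_ne_zero
  have hs' : (s : ℚ) + 1 ≠ 0 := by positivity
  simp only [gbinom, Finset.prod_range_succ, Nat.factorial_succ]
  push_cast
  field_simp

lemma succ_mul_gbinom_add_one_succ (z : ℤ) (s : ℕ) :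
    ((s : ℚ) + 1) * gbinom (z + 1) (s + 1) = ((z : ℚ) + 1) * gbinom z s := by
  have hs : (s.factorial : ℚ) ≠ 0 := Nat.cast_ne_zero.2 s.factorial_ne_zero
  have hs' : (s : ℚ) + 1 ≠ 0 := by positivity
  simp only [gbinom, Finset.prod_range_succ', Nat.factorial_succ]
  push_cast
  simp only [add_sub_add_right_eq_sub, sub_zero]
  field_simp

/-- The operator `Dop g` with its double sum cut off at `N`, as a linear map. -/
def truncDop (g N : ℕ) : MvPolynomial ℕ ℚ →ₗ[ℚ] MvPolynomial ℕ ℚ :=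
  -(g : ℚ) • (pderiv 0 : Derivation ℚ (MvPolynomial ℕ ℚ) (MvPolynomial ℕ ℚ)).toLinearMap +
    (1/2 : ℚ) • ∑ a ∈ Finset.range N, ∑ b ∈ Finset.range N,
      (((a + b + 2).choose (b + 1) : ℚ)) •
        (LinearMap.mulLeft ℚ (X (a + b)) ∘ₗ
          (pderiv a : Derivation ℚ (MvPolynomial ℕ ℚ) (MvPolynomial ℕ ℚ)).toLinearMap ∘ₗ
          (pderiv b : Derivation ℚ (MvPolynomial ℕ ℚ) (MvPolynomial ℕ ℚ)).toLinearMap)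

lemma truncDop_apply (g N : ℕ) (p : MvPolynomial ℕ ℚ) :
    truncDop g N p = -(g : ℚ) • pderiv 0 p + (1/2 : ℚ) •
      ∑ a ∈ Finset.range N, ∑ b ∈ Finset.range N,
        (((a + b + 2).choose (b + 1) : ℚ)) • (X (a + b) * pderiv a (pderiv b p)) := by
  simp [truncDop, LinearMap.sum_apply]

lemma pderiv_comm_apply (a b : ℕ) (p : MvPolynomial ℕ ℚ) :
    pderiv a (pderiv b p) = pderiv b (pderiv a p) := by
  have h : ⁅(pderiv a : Derivation ℚ (MvPolynomial ℕ ℚ) (MvPolynomial ℕ ℚ)),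
      (pderiv b : Derivation ℚ (MvPolynomial ℕ ℚ) (MvPolynomial ℕ ℚ))⁆ = 0 := by
    refine MvPolynomial.derivation_ext fun k => ?_
    simp only [Derivation.commutator_apply, pderiv_X, Pi.single_apply]
    split_ifs <;> simp
  have := congrArg
    (fun d : Derivation ℚ (MvPolynomial ℕ ℚ) (MvPolynomial ℕ ℚ) => d p) h
  simpa [Derivation.commutator_apply, sub_eq_zero] using this

lemma pderiv_eq_zero_of_sup_vars_lt {p : MvPolynomial ℕ ℚ} {b : ℕ} (h : p.vars.sup id < b) :
    pderiv b p = 0 :=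
  pderiv_eq_zero_of_notMem_vars fun hb => absurd (Finset.le_sup (f := id) hb) (not_le.2 h)

lemma Dop_eq_truncDop (g : ℕ) {N : ℕ} {p : MvPolynomial ℕ ℚ} (h : p.vars.sup id < N) :
    Dop g p = truncDop g N p := by
  have hsub : Finset.range (p.vars.sup id + 1) ⊆ Finset.range N :=
    Finset.range_subset_range.2 h
  rw [truncDop_apply, Dop]
  congr 2
  rw [← Finset.sum_subset hsub]
  · refine Finset.sum_congr rfl fun a _ => Finset.sum_subset hsub fun b _ hb => ?_
    rw [pderiv_eq_zero_of_sup_vars_lt (p := p) (b := b) (by simpa [Nat.lt_succ_iff] using hb)]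
    simp
  · intro a _ ha
    refine Finset.sum_eq_zero fun b _ => ?_
    rw [pderiv_comm_apply,
      pderiv_eq_zero_of_sup_vars_lt (p := p) (b := a) (by simpa [Nat.lt_succ_iff] using ha)]
    simp

/-- `Dop g` as a linear map. -/
def DopLin (g : ℕ) : MvPolynomial ℕ ℚ →ₗ[ℚ] MvPolynomial ℕ ℚ where
  toFun := Dop g
  map_add' p q := by
    let N := p.vars.sup id + q.vars.sup id + (p + q).vars.sup id + 1
    rw [Dop_eq_truncDop g (N := N) (p := p) (by grind),
      Dop_eq_truncDop g (N := N) (p := q) (by grind),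
      Dop_eq_truncDop g (N := N) (p := p + q) (by grind), map_add]
  map_smul' c p := by
    let N := p.vars.sup id + (c • p).vars.sup id + 1
    rw [Dop_eq_truncDop g (N := N) (p := p) (by grind),
      Dop_eq_truncDop g (N := N) (p := c • p) (by grind), map_smul, RingHom.id_apply]

/-- The Euler derivation giving the variable of index `v` the weight `v + 2`, so that its
eigenvalue on `Rij i j` is `2 * i - j`. -/
def eulerDer : Derivation ℚ (MvPolynomial ℕ ℚ) (MvPolynomial ℕ ℚ) :=
  mkDerivation ℚ fun v => ((v : ℚ) + 2) • X v

lemma eulerDer_X (v : ℕ) : eulerDer (X v) = ((v : ℚ) + 2) • X v := mkDerivation_X _ _ _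

lemma eulerDer_monomial (d : ℕ →₀ ℕ) :
    eulerDer (monomial d 1) =
      (2 * (codimW d : ℚ) - levelW d) • (monomial d 1 : MvPolynomial ℕ ℚ) := by
  rw [eulerDer, mkDerivation_monomial, one_smul]
  have key : ∀ v ∈ d.support,
      (monomial (d - Finsupp.single v 1) (d v : ℚ)) • (((v : ℚ) + 2) • X v) =
        ((d v : ℚ) * ((v : ℚ) + 2)) • (monomial d 1 : MvPolynomial ℕ ℚ) := by
    intro v hv
    have hle : Finsupp.single v 1 ≤ d := by
      rw [Finsupp.single_le_iff]
      exact Nat.one_le_iff_ne_zero.2 (Finsupp.mem_support_iff.1 hv)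
    rw [X, smul_monomial, smul_eq_mul, monomial_mul, tsub_add_cancel_of_le hle, smul_monomial]
    simp
  rw [Finsupp.sum, Finset.sum_congr rfl key, ← Finset.sum_smul]
  congr 1
  simp only [codimW, levelW, Finsupp.sum]
  push_cast
  rw [Finset.mul_sum, ← Finset.sum_sub_distrib]
  exact Finset.sum_congr rfl fun v _ => by ring

lemma eulerDer_of_mem_Rij {i j : ℕ} {α : MvPolynomial ℕ ℚ} (hα : α ∈ Rij i j) :
    eulerDer α = (2 * (i : ℚ) - j) • α := by
  induction hα using Submodule.span_induction with
  | mem p hp =>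
    obtain ⟨d, rfl, rfl, rfl⟩ := hp
    exact eulerDer_monomial d
  | zero => simp
  | add p q _ _ hp hq => rw [map_add, hp, hq, smul_add]
  | smul c p _ hp => rw [Derivation.map_smul, hp, smul_comm]

lemma sum_X_mul_pderiv {N : ℕ} {p : MvPolynomial ℕ ℚ} (h : p.vars.sup id < N) :
    ∑ b ∈ Finset.range N, ((b : ℚ) + 2) • (X b * pderiv b p) = eulerDer p := by
  let d : Derivation ℚ (MvPolynomial ℕ ℚ) (MvPolynomial ℕ ℚ) :=
    ∑ b ∈ Finset.range N, ((b : ℚ) + 2) • ((X b : MvPolynomial ℕ ℚ) • pderiv b)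
  have hd : ∀ q, d q = ∑ b ∈ Finset.range N, ((b : ℚ) + 2) • (X b * pderiv b q) := by
    intro q
    simp only [d]
    induction Finset.range N using Finset.induction_on with
    | empty => simp
    | insert b t hb ih => simp [Finset.sum_insert hb, ih]
  rw [← hd]
  refine derivation_eq_of_forall_mem_vars fun v hv => ?_
  have hvN : v ∈ Finset.range N :=
    Finset.mem_range.2 (lt_of_le_of_lt (Finset.le_sup (f := id) hv) h)
  rw [hd, eulerDer_X, Finset.sum_eq_single_of_mem v hvN]
  · simp
  · intro b _ hb
    simp [pderiv_X, hb.symm]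

lemma eulerDer_pderiv (b : ℕ) (p : MvPolynomial ℕ ℚ) :
    eulerDer (pderiv b p) = pderiv b (eulerDer p) - ((b : ℚ) + 2) • pderiv b p := by
  have h : ⁅eulerDer, (pderiv b : Derivation ℚ (MvPolynomial ℕ ℚ) (MvPolynomial ℕ ℚ))⁆ =
      -(((b : ℚ) + 2) • pderiv b) := by
    refine MvPolynomial.derivation_ext fun k => ?_
    by_cases hk : k = b <;>
      simp [Derivation.commutator_apply, eulerDer_X, pderiv_X, hk]
  have h' := congrArg (fun d => d p) h
  simp only [Derivation.commutator_apply, Derivation.neg_apply, Derivation.smul_apply] at h'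
  rw [eq_add_of_sub_eq h']
  abel

lemma eulerDer_truncDop (g N : ℕ) (p : MvPolynomial ℕ ℚ) :
    eulerDer (truncDop g N p) = truncDop g N (eulerDer p) - (2 : ℚ) • truncDop g N p := by
  have hterm : ∀ a b : ℕ, eulerDer ((((a + b + 2).choose (b + 1) : ℚ)) •
      (X (a + b) * pderiv a (pderiv b p))) =
      (((a + b + 2).choose (b + 1) : ℚ)) • (X (a + b) * pderiv a (pderiv b (eulerDer p))) -
        (2 : ℚ) • (((a + b + 2).choose (b + 1) : ℚ)) • (X (a + b) * pderiv a (pderiv b p)) := by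
    intro a b
    rw [Derivation.map_smul, Derivation.leibniz]
    simp only [eulerDer_pderiv, eulerDer_X, map_sub, Derivation.map_smul, smul_eq_mul]
    simp only [Algebra.smul_def, map_add, map_natCast, map_ofNat]
    push_cast
    ring
  have hsum : eulerDer (∑ a ∈ Finset.range N, ∑ b ∈ Finset.range N,
      (((a + b + 2).choose (b + 1) : ℚ)) • (X (a + b) * pderiv a (pderiv b p))) =
      (∑ a ∈ Finset.range N, ∑ b ∈ Finset.range N,
        (((a + b + 2).choose (b + 1) : ℚ)) • (X (a + b) * pderiv a (pderiv b (eulerDer p)))) -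
      (2 : ℚ) • ∑ a ∈ Finset.range N, ∑ b ∈ Finset.range N,
        (((a + b + 2).choose (b + 1) : ℚ)) • (X (a + b) * pderiv a (pderiv b p)) := by
    simp only [map_sum, hterm, Finset.sum_sub_distrib, Finset.smul_sum]
  rw [truncDop_apply, truncDop_apply, map_add, Derivation.map_smul, Derivation.map_smul, hsum,
    eulerDer_pderiv]
  push_cast
  module

lemma eulerDer_Dop (g : ℕ) {p : MvPolynomial ℕ ℚ} {c : ℚ} (hp : eulerDer p = c • p) :
    eulerDer (Dop g p) = (c - 2) • Dop g p := by
  rw [Dop_eq_truncDop g (Nat.lt_succ_self _), eulerDer_truncDop, hp, map_smul, sub_smul]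

lemma truncDop_X_zero_mul (g N : ℕ) (hN : 0 < N) (p : MvPolynomial ℕ ℚ) :
    truncDop g N (X 0 * p) = X 0 * truncDop g N p - (g : ℚ) • p +
      ∑ b ∈ Finset.range N, ((b : ℚ) + 2) • (X b * pderiv b p) := by
  have h0 : 0 ∈ Finset.range N := Finset.mem_range.2 hN
  have hX : ∀ b q, pderiv b (X 0 * q) =
      X 0 * pderiv b q + if b = 0 then q else (0 : MvPolynomial ℕ ℚ) := by
    intro b q
    by_cases hb : b = 0 <;> simp [Derivation.leibniz, pderiv_X, hb, eq_comm]
  have hterm : ∀ a b : ℕ, (((a + b + 2).choose (b + 1) : ℚ)) •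
      (X (a + b) * pderiv a (pderiv b (X 0 * p))) =
      X 0 * ((((a + b + 2).choose (b + 1) : ℚ)) • (X (a + b) * pderiv a (pderiv b p))) +
      ((if a = 0 then ((b : ℚ) + 2) • (X b * pderiv b p) else 0) +
        (if b = 0 then ((a : ℚ) + 2) • (X a * pderiv a p) else 0)) := by
    intro a b
    have hc : ((0 + b + 2).choose (b + 1) : ℚ) = b + 2 := by
      rw [zero_add, Nat.choose_succ_self_right]; push_cast; ring
    have hc' : ((a + 0 + 2).choose (0 + 1) : ℚ) = a + 2 := by
      rw [add_zero, zero_add, Nat.choose_one_right]; push_cast; ring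
    rw [hX, map_add, hX, mul_add, mul_add, smul_add, smul_add, mul_left_comm, mul_smul_comm,
      ← add_assoc]
    congr 1
    · congr 1
      split_ifs with ha
      · subst ha; rw [hc, zero_add]
      · simp
    · split_ifs with hb
      · subst hb; rw [hc', add_zero]
      · simp
  rw [truncDop_apply, truncDop_apply, hX, if_pos rfl]
  simp only [hterm, Finset.sum_add_distrib, Finset.sum_ite_irrel, Finset.sum_const_zero,
    Finset.sum_ite_eq', h0, if_true, ← Finset.mul_sum]
  simp only [mul_add, mul_smul_comm, smul_add]
  module

lemma Dop_X_zero_mul (g : ℕ) {p : MvPolynomial ℕ ℚ} {c : ℚ} (hp : eulerDer p = c • p) :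
    Dop g (X 0 * p) = X 0 * Dop g p + (c - g) • p := by
  let N := p.vars.sup id + (X 0 * p).vars.sup id + 1
  have hN : p.vars.sup id < N := by grind
  rw [Dop_eq_truncDop g (N := N) (p := p) hN,
    Dop_eq_truncDop g (N := N) (p := X 0 * p) (by grind),
    truncDop_X_zero_mul g N (by grind), sum_X_mul_pderiv hN, hp]
  module

lemma eulerDer_X_zero_pow_mul {p : MvPolynomial ℕ ℚ} {c : ℚ} (hp : eulerDer p = c • p) (a : ℕ) :
    eulerDer (X 0 ^ a * p) = (c + 2 * a) • (X 0 ^ a * p) := by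
  induction a with
  | zero => simp [hp]
  | succ a ih =>
    rw [pow_succ', mul_assoc, Derivation.leibniz, ih, eulerDer_X]
    simp only [smul_eq_mul]
    simp only [Algebra.smul_def, map_add, map_mul, map_natCast, map_ofNat]
    push_cast
    ring

lemma Dop_X_zero_pow_mul (g : ℕ) {p : MvPolynomial ℕ ℚ} {c : ℚ} (hp : eulerDer p = c • p)
    (a : ℕ) :
    Dop g (X 0 ^ a * p) =
      X 0 ^ a * Dop g p + ((a : ℚ) * (c - g + a - 1)) • (X 0 ^ (a - 1) * p) := by
  induction a with
  | zero => simp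
  | succ a ih =>
    rw [pow_succ', mul_assoc, Dop_X_zero_mul g (eulerDer_X_zero_pow_mul hp a), ih]
    rcases a with _ | a
    · simp
    · simp only [Nat.add_sub_cancel, Algebra.smul_def, map_add, map_mul, map_sub, map_natCast,
        map_ofNat]
      push_cast
      ring

lemma iterate_Dop_X_zero_pow_mul (g n : ℕ) : ∀ (a : ℕ) (c : ℤ) (α : MvPolynomial ℕ ℚ),
    eulerDer α = (c : ℚ) • α →
    (Dop g)^[n] (X 0 ^ a * α) = ∑ s ∈ Finset.range (n + 1),
      ((n.descFactorial s : ℚ) * a.descFactorial s * gbinom (c - g + a - n + s - 1) s) •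
        (X 0 ^ (a - s) * (Dop g)^[n - s] α) := by
  induction n with
  | zero => intro a c α _; simp [gbinom_zero]
  | succ n ih =>
    intro a c α hα
    have hadd : ∀ p q, (Dop g)^[n] (p + q) = (Dop g)^[n] p + (Dop g)^[n] q :=
      iterate_map_add (DopLin g) n
    have hsmul : ∀ (r : ℚ) p, (Dop g)^[n] (r • p) = r • (Dop g)^[n] p :=
      fun r p => Function.Semiconj.iterate_right
        (fun q => ((DopLin g).map_smul r q).symm) n p |>.symm
    have hDα : eulerDer (Dop g α) = ((c - 2 : ℤ) : ℚ) • Dop g α := by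
      push_cast
      exact eulerDer_Dop g hα
    rw [Function.iterate_succ_apply, Dop_X_zero_pow_mul g hα, hadd, hsmul, ih a _ _ hDα,
      ih (a - 1) c α hα]
    have hext : ∀ f : ℕ → MvPolynomial ℕ ℚ, f (n + 1) = 0 →
        ∑ s ∈ Finset.range (n + 1), f s = ∑ s ∈ Finset.range (n + 1), f (s + 1) + f 0 := by
      intro f hf
      rw [← Finset.sum_range_succ' f, Finset.sum_range_succ f (n + 1), hf, add_zero]
    rw [hext _ (by simp), Finset.sum_range_succ' _ (n + 1), add_right_comm, Finset.smul_sum,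
      ← Finset.sum_add_distrib]
    congr 1
    refine Finset.sum_congr rfl fun s hs => ?_
    have hsn : s ≤ n := Nat.lt_succ_iff.1 (Finset.mem_range.1 hs)
    rcases a with _ | a
    · simp
    have hD : ((n - s : ℕ) : ℚ) • (Dop g)^[n - (s + 1)] (Dop g α) =
        ((n - s : ℕ) : ℚ) • (Dop g)^[n - s] α := by
      rcases hsn.eq_or_lt with rfl | hlt
      · simp
      · rw [← Function.iterate_succ_apply, show (n - (s + 1)).succ = n - s by omega]
    have hfirst : ∀ r : ℚ, ∀ q : MvPolynomial ℕ ℚ,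
        (((n - s : ℕ) : ℚ) * r) • (q * (Dop g)^[n - (s + 1)] (Dop g α)) =
          (((n - s : ℕ) : ℚ) * r) • (q * (Dop g)^[n - s] α) := by
      intro r q
      rw [mul_comm, mul_smul, ← mul_smul_comm, hD, mul_smul_comm, ← mul_smul]
    rw [Nat.descFactorial_succ n, Nat.succ_descFactorial_succ a, Nat.succ_descFactorial_succ n,
      Nat.cast_mul, mul_assoc, mul_assoc, hfirst, smul_smul, Nat.add_sub_cancel,
      Nat.add_sub_add_right, Nat.add_sub_add_right, ← add_smul]
    congr 1
    set z : ℤ := c - g + a - n + s - 1 with hz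
    have e1 : c - 2 - g + ((a + 1 : ℕ) : ℤ) - n + ((s + 1 : ℕ) : ℤ) - 1 = z := by
      push_cast; ring
    have e2 : c - g + ((a + 1 : ℕ) : ℤ) - ((n + 1 : ℕ) : ℤ) + ((s + 1 : ℕ) : ℤ) - 1 = z + 1 := by
      push_cast; ring
    rw [e1, e2]
    have hzq : (z : ℚ) = c - g + a - n + s - 1 := by rw [hz]; push_cast; ring
    have h1 := succ_mul_gbinom_succ z s
    have h2 := succ_mul_gbinom_add_one_succ z s
    have hs0 : (s : ℚ) + 1 ≠ 0 := by positivity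
    rw [show gbinom z (s + 1) = (z - s) * gbinom z s / (s + 1) by
        rw [eq_div_iff hs0, ← h1]; ring,
      show gbinom (z + 1) (s + 1) = (z + 1) * gbinom z s / (s + 1) by
        rw [eq_div_iff hs0, ← h2]; ring, hzq]
    push_cast [Nat.cast_sub hsn]
    field_simp
    ring

/-- Lemma on `𝒟ⁿ(x₁^a · α)`: for `g ≥ 3`, `α ∈ R^i_{(j)}`, and all
`n, a ≥ 0`,
`𝒟ⁿ(x₁^a·α) = ∑_{s=0}^{min(n,a)} (n!/(n−s)!)(a!/(a−s)!) binom(2i−j−g+a−n+s−1, s)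
  x₁^{a−s} 𝒟^{n−s}(α)`. -/
theorem stmt0 (g : ℕ) (hg : 3 ≤ g) (i j : ℕ) (α : MvPolynomial ℕ ℚ)
    (hα : α ∈ Rij i j) (n a : ℕ) :
    (Dop g)^[n] (X 0 ^ a * α) =
      ∑ s ∈ Finset.range (min n a + 1),
        (((n.factorial : ℚ) / (n - s).factorial) * ((a.factorial : ℚ) / (a - s).factorial) *
            gbinom (2 * (i : ℤ) - j - g + a - n + s - 1) s) •
          (X 0 ^ (a - s) * (Dop g)^[n - s] α) := by
  have hE : eulerDer α = ((2 * (i : ℤ) - j : ℤ) : ℚ) • α := by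
    push_cast
    exact eulerDer_of_mem_Rij hα
  rw [iterate_Dop_X_zero_pow_mul g n a _ α hE]
  symm
  refine (Finset.sum_congr rfl fun s hs => ?_).trans
    (Finset.sum_subset (Finset.range_subset_range.2 (by omega)) fun s hs hs' => ?_)
  · have hs : s ≤ min n a := Nat.lt_succ_iff.1 (Finset.mem_range.1 hs)
    have hcast : ∀ m : ℕ, s ≤ m →
        (m.factorial : ℚ) / (m - s).factorial = m.descFactorial s := by
      intro m hm
      rw [div_eq_iff (Nat.cast_ne_zero.2 (Nat.factorial_ne_zero _)),
        ← Nat.factorial_mul_descFactorial hm]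
      push_cast
      ring
    rw [hcast n (by omega), hcast a (by omega)]
  · rw [Finset.mem_range] at hs hs'
    rw [Nat.descFactorial_eq_zero_iff_lt.2 (show a < s by omega)]
    simp
end
end

section
/- Let i, j be integers with j ≥ 0 and 2i − j ≤ g, and let g′ > g be another integer. Writing μ_g(i,j) = dim_ℚ( M^i_{(j)} / 𝒟^{g−2i+j+1}(M^{g−i+j+1}_{(j)}) ) and μ_{g′}(i,j) = dim_ℚ( M^i_{(j)} / 𝒟^{g′−2i+j+1}(M^{g′−i+j+1}_{(j)}) ) (these are well defined since 𝒟 restricted to the spaces M^k_{(j)} does not depend on the parameter g), one has μ_{g′}(i, j) ≥ μ_g(i, j); equivalently, the multiplicity of V(g′−2i+j) in 𝓡[g′]_{(j)} is at least the multiplicity of V(g−2i+j) in 𝓡[g]_{(j)}. -/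
/- We model `R = ℚ[x₁, x₂, …]` as `MvPolynomial ℕ ℚ`, the variable of index `v`
representing `x_{v+1}`. -/

open MvPolynomial

noncomputable section

/-- `M^i_{(j)}`: span of monomials in `x₂, x₃, …` (no `x₁`) of codimension `i`, level `j`. -/
def Mij (i j : ℕ) : Submodule ℚ (MvPolynomial ℕ ℚ) :=
  Submodule.span ℚ
    { p | ∃ d : ℕ →₀ ℕ, d 0 = 0 ∧ codimW d = i ∧ levelW d = j ∧ p = monomial d (1 : ℚ) }

/-- The multiplicity `μ_g(i,j) = dim_ℚ( M^i_{(j)} / 𝒟^{g−2i+j+1}(M^{g−i+j+1}_{(j)}) )`,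
the multiplicity of `V(g−2i+j)` in `𝓡[g]_{(j)}`. -/
def muIJ (g i j : ℕ) : ℕ :=
  Module.finrank ℚ
    (↥(Mij i j) ⧸
      (Submodule.span ℚ
        ((Dop g)^[g + j + 1 - 2 * i] ''
          (Mij (g + j + 1 - i) j : Set (MvPolynomial ℕ ℚ)))).comap (Mij i j).subtype)

/-- To show that a linear map sends `M^i_{(j)}` into a subspace, it suffices to check monomials. -/
theorem map_mem_of_monomial_mem {i j : ℕ} (f : MvPolynomial ℕ ℚ →ₗ[ℚ] MvPolynomial ℕ ℚ)
    (W : Submodule ℚ (MvPolynomial ℕ ℚ))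
    (h : ∀ d : ℕ →₀ ℕ, d 0 = 0 → codimW d = i → levelW d = j → f (monomial d 1) ∈ W)
    {p : MvPolynomial ℕ ℚ} (hp : p ∈ Mij i j) : f p ∈ W := by
  have hle : Mij i j ≤ W.comap f := by
    refine Submodule.span_le.2 ?_
    rintro _ ⟨d, h0, hc, hl, rfl⟩
    exact h d h0 hc hl
  exact hle hp

theorem pderiv_zero_eq_zero_of_mem_Mij {i j : ℕ} {p : MvPolynomial ℕ ℚ} (hp : p ∈ Mij i j) :
    pderiv 0 p = 0 := by
  have h := map_mem_of_monomial_mem (pderiv (R := ℚ) (0 : ℕ)).toLinearMap ⊥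
    (fun d h0 _ _ => by simp [pderiv_monomial, h0]) hp
  simpa using h

theorem codimW_add (d e : ℕ →₀ ℕ) : codimW (d + e) = codimW d + codimW e :=
  Finsupp.sum_add_index' (by simp) (by intros; ring)

theorem levelW_add (d e : ℕ →₀ ℕ) : levelW (d + e) = levelW d + levelW e :=
  Finsupp.sum_add_index' (by simp) (by intros; ring)

theorem codimW_single (v n : ℕ) : codimW (Finsupp.single v n) = (v + 1) * n :=
  Finsupp.sum_single_index (by simp)

theorem levelW_single (v n : ℕ) : levelW (Finsupp.single v n) = v * n :=
  Finsupp.sum_single_index (by simp)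

/-- The second-order summands of `𝒟` lower the codimension by one and keep the level. -/
theorem X_mul_pderiv_pderiv_mem_Mij {i j : ℕ} (a b : ℕ) {p : MvPolynomial ℕ ℚ}
    (hp : p ∈ Mij (i + 1) j) : X (a + b) * pderiv a (pderiv b p) ∈ Mij i j := by
  refine map_mem_of_monomial_mem
    ((LinearMap.mulLeft ℚ (X (a + b))).comp
      ((pderiv (R := ℚ) a).toLinearMap.comp (pderiv (R := ℚ) b).toLinearMap)) _ ?_ hp
  intro d h0 hc hl
  simp only [LinearMap.comp_apply, LinearMap.mulLeft_apply,
    Derivation.coeFn_coe, pderiv_monomial, one_mul]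
  by_cases hb : d b = 0
  · simp [hb]
  obtain ⟨e, rfl⟩ : ∃ e, d = e + Finsupp.single b 1 :=
    ⟨d - Finsupp.single b 1, (tsub_add_cancel_of_le (by
      rw [Finsupp.single_le_iff]; omega)).symm⟩
  rw [add_tsub_cancel_right]
  by_cases ha : e a = 0
  · simp [ha]
  obtain ⟨f, rfl⟩ : ∃ f, e = f + Finsupp.single a 1 :=
    ⟨e - Finsupp.single a 1, (tsub_add_cancel_of_le (by
      rw [Finsupp.single_le_iff]; omega)).symm⟩
  rw [add_tsub_cancel_right, X, monomial_mul, one_mul, ← mul_one (_ * _ : ℚ), ← smul_eq_mul,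
    ← smul_monomial]
  refine Submodule.smul_mem _ _ (Submodule.subset_span ⟨_, ?_, ?_, ?_, rfl⟩)
  · simp only [Finsupp.add_apply, Finsupp.single_apply] at h0 ⊢
    split_ifs at h0 ⊢ <;> omega
  · simp only [codimW_add, codimW_single] at hc ⊢
    omega
  · simp only [levelW_add, levelW_single] at hl ⊢
    omega

theorem Dop_mem_Mij (g : ℕ) {i j : ℕ} {p : MvPolynomial ℕ ℚ} (hp : p ∈ Mij (i + 1) j) :
    Dop g p ∈ Mij i j := by
  rw [Dop, pderiv_zero_eq_zero_of_mem_Mij hp, smul_zero, zero_add]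
  exact Submodule.smul_mem _ _ (Submodule.sum_mem _ fun a _ => Submodule.sum_mem _ fun b _ =>
    Submodule.smul_mem _ _ (X_mul_pderiv_pderiv_mem_Mij a b hp))

/-- On polynomials not involving `x₁` the operator `𝒟` does not depend on the parameter. -/
theorem Dop_eq_of_mem_Mij (g g' : ℕ) {i j : ℕ} {p : MvPolynomial ℕ ℚ} (hp : p ∈ Mij i j) :
    Dop g p = Dop g' p := by
  simp only [Dop, pderiv_zero_eq_zero_of_mem_Mij hp, smul_zero]

theorem iterate_Dop_mem_Mij (g : ℕ) {i j : ℕ} (n : ℕ) {p : MvPolynomial ℕ ℚ}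
    (hp : p ∈ Mij (i + n) j) : (Dop g)^[n] p ∈ Mij i j := by
  induction n generalizing p with
  | zero => exact hp
  | succ n ih => exact ih (Dop_mem_Mij g hp)

theorem iterate_Dop_eq_of_mem_Mij (g g' : ℕ) {i j : ℕ} (n : ℕ) {p : MvPolynomial ℕ ℚ}
    (hp : p ∈ Mij (i + n) j) : (Dop g)^[n] p = (Dop g')^[n] p := by
  induction n generalizing p with
  | zero => rfl
  | succ n ih =>
    rw [Function.iterate_succ_apply, Function.iterate_succ_apply, ih (Dop_mem_Mij g hp),
      Dop_eq_of_mem_Mij g g' hp]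

theorem mul_apply_le_codimW (d : ℕ →₀ ℕ) (v : ℕ) : (v + 1) * d v ≤ codimW d := by
  by_cases hv : d v = 0
  · simp [hv]
  · exact Finset.single_le_sum (f := fun v => (v + 1) * d v) (fun _ _ => Nat.zero_le _)
      (Finsupp.mem_support_iff.2 hv)

theorem finite_setOf_codimW_eq (i : ℕ) : {d : ℕ →₀ ℕ | codimW d = i}.Finite := by
  refine (Set.finite_Iic (Finsupp.indicator (Finset.range i) fun _ _ => i)).subset fun d hd v => ?_
  have h := mul_apply_le_codimW d v
  rw [show codimW d = i from hd] at h
  rw [Finsupp.indicator_apply]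
  split_ifs with hv
  · nlinarith
  · rw [Finset.mem_range] at hv
    by_contra! hpos
    nlinarith

instance finite_Mij (i j : ℕ) : Module.Finite ℚ (Mij i j) := by
  refine FiniteDimensional.span_of_finite ℚ
    (((finite_setOf_codimW_eq i).image fun d => monomial d (1 : ℚ)).subset ?_)
  rintro _ ⟨d, -, hc, -, rfl⟩
  exact ⟨d, hc, rfl⟩

/-- for `2i − j ≤ g < g′` one has `μ_{g′}(i, j) ≥ μ_g(i, j)`;
equivalently, the multiplicity of `V(g′−2i+j)` in `𝓡[g′]_{(j)}` is at least the
multiplicity of `V(g−2i+j)` in `𝓡[g]_{(j)}`.  (The operator `𝒟` restricted to the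
spaces `M^k_{(j)}` does not depend on the parameter `g`, so each side may be computed
with its own `g`.) -/
theorem stmt2 (g g' i j : ℕ) (hg : 3 ≤ g) (hgg' : g < g') (hij : 2 * i ≤ g + j) :
    muIJ g i j ≤ muIJ g' i j := by
  refine LinearMap.finrank_le_finrank_of_surjective
    (f := Submodule.factor (Submodule.comap_mono (Submodule.span_mono ?_)))
    (Submodule.factor_surjective _)
  rintro _ ⟨p, hp, rfl⟩
  obtain ⟨k, rfl⟩ := Nat.exists_eq_add_of_lt hgg'
  obtain ⟨n, hn⟩ := Nat.exists_eq_add_of_le hij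
  have hsrc : g + j + 1 - i = i + (n + 1) := by omega
  have hsrc' : g + k + 1 + j + 1 - i = i + (n + 1) + (k + 1) := by omega
  have hexp : g + j + 1 - 2 * i = n + 1 := by omega
  have hexp' : g + k + 1 + j + 1 - 2 * i = (n + 1) + (k + 1) := by omega
  rw [hsrc'] at hp
  rw [hexp, hexp', hsrc]
  have hmem := iterate_Dop_mem_Mij (g + k + 1) (k + 1) hp
  refine ⟨_, hmem, ?_⟩
  rw [iterate_Dop_eq_of_mem_Mij g (g + k + 1) (n + 1) hmem, ← Function.iterate_add_apply]
end
end
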